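/- arXiv:2107.11854 — 3 statements merged into one kernel-verified Lean document; each statement's English description precedes it below -/
import Mathlib

section
/- Let p₀, q₀ > 0 and let (p,q) be a pair with 0 < p, q < ∞ that does NOT satisfy all three conditions p ≤ p₀, q ≤ q₀, q₀/p₀ ≤ q/p. Then there exist sequences x and y, each having at most two non-zero entries, such that x ≶ y, ‖x‖_{ℓ(p₀,q₀)} > ‖y‖_{ℓ(p₀,q₀)}, and ‖x‖_{ℓ(p,q)} < ‖y‖_{ℓ(p,q)}. -/
open MeasureTheory Set Real Filter
open scoped ENNReal NNReal

/-- The non-increasing rearrangement of the sequence `(|x_n|)`; with the indexing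
starting from `0`, `(seqRearr x n)` is the `(n+1)`-st term `x*_{n+1}` of the paper:
`x*_{n+1} = inf {τ > 0 : #{m : |x_m| > τ} ≤ n}`. -/
noncomputable def seqRearr (x : ℕ → ℝ) (n : ℕ) : ℝ :=
  sInf {τ : ℝ | 0 < τ ∧ Measure.count {m : ℕ | τ < |x m|} ≤ (n : ℝ≥0∞)}

/-- The Lorentz sequence quasi-norm `‖x‖_{ℓ(p,q)} = (Σ_{n≥1} (x_n*)^q n^{q/p−1})^{1/q}`,
valued in `ℝ≥0∞`. -/
noncomputable def seqLorentzNorm (p q : ℝ) (x : ℕ → ℝ) : ℝ≥0∞ :=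
  (∑' n : ℕ, ENNReal.ofReal (seqRearr x n ^ q * ((n : ℝ) + 1) ^ (q / p - 1))) ^ (1 / q)

/-- `x ≶ y`: there is `n₀ ≥ 1` with `x_n* ≤ y_n*` for `n ≤ n₀` and `x_n* ≥ y_n*`
for `n > n₀` (in the paper's `1`-based indexing). -/
def SeqCross (x y : ℕ → ℝ) : Prop :=
  ∃ n₀ : ℕ, 1 ≤ n₀ ∧ ∀ n : ℕ,
    (n + 1 ≤ n₀ → seqRearr x n ≤ seqRearr y n) ∧
    (n₀ < n + 1 → seqRearr y n ≤ seqRearr x n)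


theorem seqRearr_eq_self {x : ℕ → ℝ} (hx : Antitone x) (h0 : ∀ n, 0 ≤ x n) (n : ℕ) :
    seqRearr x n = x n := by
  have hset : {τ : ℝ | 0 < τ ∧ Measure.count {m : ℕ | τ < |x m|} ≤ (n : ℝ≥0∞)} =
      {τ : ℝ | 0 < τ ∧ x n ≤ τ} := by
    ext τ
    simp only [mem_ofPred_eq, abs_of_nonneg (h0 _)]
    refine and_congr_right fun _ => ⟨fun h => ?_, fun h => ?_⟩
    · by_contra! hlt
      have hsub : ((Finset.range (n + 1) : Finset ℕ) : Set ℕ) ⊆ {m : ℕ | τ < x m} := by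
        intro m hm
        have hm' : m ≤ n := by simpa [Nat.lt_succ_iff] using hm
        exact hlt.trans_le (hx hm')
      have hle := (measure_mono (μ := Measure.count) hsub).trans h
      rw [Measure.count_apply_finset, Finset.card_range] at hle
      have : n + 1 ≤ n := by exact_mod_cast hle
      omega
    · have hsub : {m : ℕ | τ < x m} ⊆ ((Finset.range n : Finset ℕ) : Set ℕ) := by
        intro m hm
        have hm' : τ < x m := hm
        by_contra hmn
        have hnm : n ≤ m := by simpa using hmn
        exact absurd (hm'.trans_le ((hx hnm).trans h)) (lt_irrefl _)
      have hle := measure_mono (μ := Measure.count) hsub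
      rwa [Measure.count_apply_finset, Finset.card_range] at hle
  rw [seqRearr, hset]
  rcases (h0 n).eq_or_lt with h | h
  · have : {τ : ℝ | 0 < τ ∧ x n ≤ τ} = Ioi 0 := by
      ext τ
      simp only [mem_ofPred_eq, mem_Ioi, ← h]
      exact ⟨fun k => k.1, fun k => ⟨k, k.le⟩⟩
    rw [this, csInf_Ioi, h]
  · have : {τ : ℝ | 0 < τ ∧ x n ≤ τ} = Ici (x n) := by
      ext τ
      simp only [mem_ofPred_eq, mem_Ici]
      exact ⟨fun k => k.2, fun k => ⟨h.trans_le k, k⟩⟩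
    rw [this, csInf_Ici]

/-- The sequence `(a, b, 0, 0, …)`. -/
def pairSeq (a b : ℝ) (n : ℕ) : ℝ := if n = 0 then a else if n = 1 then b else 0

theorem support_pairSeq_subset (a b : ℝ) :
    {n : ℕ | pairSeq a b n ≠ 0} ⊆ (({0, 1} : Finset ℕ) : Set ℕ) := by
  intro n hn
  by_contra h
  simp only [Finset.coe_insert, Finset.coe_singleton, mem_insert_iff, mem_singleton_iff,
    not_or] at h
  exact hn (by simp [pairSeq, h.1, h.2])

theorem finite_support_pairSeq (a b : ℝ) : {n : ℕ | pairSeq a b n ≠ 0}.Finite :=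
  (Finset.finite_toSet _).subset (support_pairSeq_subset a b)

theorem ncard_support_pairSeq_le (a b : ℝ) : {n : ℕ | pairSeq a b n ≠ 0}.ncard ≤ 2 := by
  have h := ncard_le_ncard (support_pairSeq_subset a b) (Finset.finite_toSet _)
  rw [ncard_coe_finset] at h
  exact h

theorem seqRearr_pairSeq {a b : ℝ} (hb : 0 ≤ b) (hba : b ≤ a) (n : ℕ) :
    seqRearr (pairSeq a b) n = pairSeq a b n := by
  refine seqRearr_eq_self (antitone_nat_of_succ_le fun n => ?_) (fun n => ?_) n
  · rcases n with _ | _ | n <;> simp [pairSeq, hb, hba]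
  · unfold pairSeq
    split_ifs <;> linarith

theorem seqLorentzNorm_pairSeq {p q a b : ℝ} (hq : 0 < q) (hb : 0 ≤ b) (hba : b ≤ a) :
    seqLorentzNorm p q (pairSeq a b) =
      ENNReal.ofReal (a ^ q + 2 ^ (q / p - 1) * b ^ q) ^ (1 / q) := by
  have ha : 0 ≤ a := hb.trans hba
  rw [seqLorentzNorm, tsum_eq_sum (s := Finset.range 2), Finset.sum_range_succ,
    Finset.sum_range_one, ← ENNReal.ofReal_add]
  · simp only [seqRearr_pairSeq hb hba]
    norm_num [pairSeq, mul_comm]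
  · rw [seqRearr_pairSeq hb hba]
    simp only [pairSeq, if_true]
    positivity
  · rw [seqRearr_pairSeq hb hba]
    simp only [pairSeq, if_true, one_ne_zero, if_false]
    positivity
  · intro n hn
    have hn' : 2 ≤ n := by simpa [Nat.succ_le_iff] using hn
    rw [seqRearr_pairSeq hb hba]
    simp [pairSeq, show n ≠ 0 by omega, show n ≠ 1 by omega, zero_rpow hq.ne']

theorem seqLorentzNorm_pairSeq_lt {p q a b c d : ℝ} (hq : 0 < q) (hb : 0 ≤ b) (hba : b ≤ a)
    (hd : 0 ≤ d) (hdc : d ≤ c)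
    (h : a ^ q + 2 ^ (q / p - 1) * b ^ q < c ^ q + 2 ^ (q / p - 1) * d ^ q) :
    seqLorentzNorm p q (pairSeq a b) < seqLorentzNorm p q (pairSeq c d) := by
  have ha : 0 ≤ a := hb.trans hba
  rw [seqLorentzNorm_pairSeq hq hb hba, seqLorentzNorm_pairSeq hq hd hdc]
  refine ENNReal.rpow_lt_rpow ?_ (by positivity)
  exact (ENNReal.ofReal_lt_ofReal_iff_of_nonneg (by positivity)).2 h

theorem seqCross_pairSeq {a b c d : ℝ} (hba : b ≤ a) (hd : 0 ≤ d) (hdc : d ≤ c)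
    (hac : a ≤ c) (hdb : d ≤ b) : SeqCross (pairSeq a b) (pairSeq c d) := by
  refine ⟨1, le_rfl, fun n => ?_⟩
  rw [seqRearr_pairSeq (hd.trans hdb) hba, seqRearr_pairSeq hd hdc]
  rcases n with _ | _ | n <;> simp [pairSeq, hac, hdb]

/-- A larger weight distinguishes `(a, a)` from `(1, d)` with `a`, `d` close to `1`. -/
theorem exists_pair_of_weight_lt {q₀ q w₀ w : ℝ} (hq₀ : 0 < q₀) (hq : 0 < q)
    (hw : 0 < w) (hlt : w < w₀) :
    ∃ a b c d : ℝ, b ≤ a ∧ 0 ≤ d ∧ d ≤ c ∧ a ≤ c ∧ d ≤ b ∧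
      c ^ q₀ + w₀ * d ^ q₀ < a ^ q₀ + w₀ * b ^ q₀ ∧
      a ^ q + w * b ^ q < c ^ q + w * d ^ q := by
  have hw₀ : 0 < w₀ := hw.trans hlt
  obtain ⟨θ, hθ⟩ : ∃ θ, θ = w / (1 + w) := ⟨_, rfl⟩
  obtain ⟨θ₀, hθ₀⟩ : ∃ θ₀, θ₀ = w₀ / (1 + w₀) := ⟨_, rfl⟩
  have e : θ * (1 + w) = w := by rw [hθ]; field_simp
  have e₀ : θ₀ * (1 + w₀) = w₀ := by rw [hθ₀]; field_simp
  have hθpos : 0 < θ := by rw [hθ]; positivity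
  have hθ₀lt : θ₀ < 1 := by rw [hθ₀, div_lt_one (by positivity)]; linarith
  have hθθ : θ < θ₀ := by
    rw [hθ, hθ₀, div_lt_div_iff₀ (by positivity) (by positivity)]; nlinarith
  obtain ⟨D, hD⟩ : ∃ D, D = 1 - θ₀ + θ := ⟨_, rfl⟩
  have hD0 : 0 < D := by linarith
  have hD1 : D < 1 := by linarith
  obtain ⟨d, hd⟩ : ∃ d, d = D ^ (1 / q₀) := ⟨_, rfl⟩
  have hd0 : 0 < d := by rw [hd]; positivity
  have hd1 : d < 1 := by rw [hd]; exact rpow_lt_one hD0.le hD1 (by positivity)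
  have hdq₀ : d ^ q₀ = D := by
    rw [hd, ← rpow_mul hD0.le, one_div_mul_cancel hq₀.ne', rpow_one]
  have hcomm : ∀ r : ℝ, (d ^ θ) ^ r = (d ^ r) ^ θ := fun r => by
    rw [← rpow_mul hd0.le, ← rpow_mul hd0.le, mul_comm]
  have hda : d ≤ d ^ θ := by
    simpa using rpow_le_rpow_of_exponent_ge hd0 hd1.le (hθθ.trans hθ₀lt).le
  refine ⟨d ^ θ, d ^ θ, 1, d, le_rfl, hd0.le, hd1.le, rpow_le_one hd0.le hd1.le hθpos.le,
    hda, ?_, ?_⟩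
  · rw [hcomm, hdq₀, one_rpow]
    have hB : (1 + (D⁻¹ - 1)) ^ θ ≤ 1 + θ * (D⁻¹ - 1) :=
      rpow_one_add_le_one_add_mul_self (by have : 0 < D⁻¹ := by positivity
                                           linarith) hθpos.le (hθθ.trans hθ₀lt).le
    rw [add_sub_cancel, inv_rpow hD0.le] at hB
    have hP : 0 < D ^ θ := by positivity
    have hB' : D ≤ D ^ θ * (D + θ * (1 - D)) := by
      calc D = D ^ θ * D * (D ^ θ)⁻¹ := by field_simp
        _ ≤ D ^ θ * D * (1 + θ * (D⁻¹ - 1)) := by gcongr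
        _ = _ := by field_simp
    have hS : 0 < D + θ * (1 - D) := by nlinarith
    have key : 1 - θ₀ * (1 - D) < D ^ θ := by
      by_contra! hcon
      have h1 : D ≤ (1 - θ₀ * (1 - D)) * (D + θ * (1 - D)) :=
        hB'.trans (mul_le_mul_of_nonneg_right hcon hS.le)
      have hδ : 0 < θ₀ - θ := by linarith
      have h2 : θ₀ * (1 - θ) < 1 := by nlinarith
      have h3 : (1 - θ₀ * (1 - D)) * (D + θ * (1 - D)) - D =
          (θ₀ - θ) ^ 2 * (θ₀ * (1 - θ) - 1) := by rw [hD]; ring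
      have h4 : (θ₀ - θ) ^ 2 * (θ₀ * (1 - θ) - 1) < 0 :=
        mul_neg_of_pos_of_neg (by positivity) (by linarith)
      linarith
    have h5 := mul_lt_mul_of_pos_right key (show 0 < 1 + w₀ by positivity)
    have h6 : (1 - θ₀ * (1 - D)) * (1 + w₀) = 1 + w₀ * D := by
      linear_combination (D - 1) * e₀
    linarith
  · rw [hcomm, one_rpow]
    obtain ⟨E, hE⟩ : ∃ E, E = d ^ q := ⟨_, rfl⟩
    have hE0 : 0 < E := by rw [hE]; positivity
    have hE1 : E < 1 := by rw [hE]; exact rpow_lt_one hd0.le hd1 hq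
    rw [← hE]
    have hB : (1 + (E - 1)) ^ θ < 1 + θ * (E - 1) :=
      rpow_one_add_lt_one_add_mul_self (by linarith) (by linarith) hθpos (hθθ.trans hθ₀lt)
    rw [add_sub_cancel] at hB
    have h5 := mul_lt_mul_of_pos_right hB (show 0 < 1 + w by positivity)
    have h6 : (1 + θ * (E - 1)) * (1 + w) = 1 + w * E := by
      linear_combination (E - 1) * e
    linarith

/-- A larger summability exponent distinguishes `(1, 0)` from `(a, b)` with `b` small. -/
theorem exists_pair_of_exponent_lt {q₀ q w₀ w : ℝ} (hq₀ : 0 < q₀) (hlt : q₀ < q)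
    (hw₀ : 0 < w₀) :
    ∃ a b c d : ℝ, b ≤ a ∧ 0 ≤ d ∧ d ≤ c ∧ a ≤ c ∧ d ≤ b ∧
      c ^ q₀ + w₀ * d ^ q₀ < a ^ q₀ + w₀ * b ^ q₀ ∧
      a ^ q + w * b ^ q < c ^ q + w * d ^ q := by
  have hq : 0 < q := hq₀.trans hlt
  have hr : 1 < q / q₀ := (one_lt_div hq₀).2 hlt
  have hlim : Tendsto (fun u : ℝ => w * u ^ (q / q₀ - 1)) (nhdsWithin 0 (Ioi 0)) (nhds 0) := by
    have h := ((continuousAt_rpow_const 0 (q / q₀ - 1) (Or.inr (by linarith))).tendsto).const_mul w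
    rw [zero_rpow (by linarith), mul_zero] at h
    exact h.mono_left nhdsWithin_le_nhds
  have hsmall : ∀ᶠ u : ℝ in nhdsWithin 0 (Ioi 0), u < 1 / (1 + w₀ / 2) :=
    nhdsWithin_le_nhds (Iio_mem_nhds (by positivity))
  obtain ⟨u, h1, h2, hu⟩ := ((hlim.eventually (gt_mem_nhds (show 0 < w₀ / 2 by positivity))).and
    (hsmall.and self_mem_nhdsWithin)).exists
  have hu : 0 < u := hu
  rw [lt_div_iff₀ (by positivity)] at h2
  obtain ⟨A, hA⟩ : ∃ A, A = 1 - w₀ / 2 * u := ⟨_, rfl⟩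
  have huA : u ≤ A := by linarith
  have hA0 : 0 < A := hu.trans_le huA
  have hA1 : A ≤ 1 := by have : 0 < w₀ / 2 * u := by positivity
                         linarith
  have hpow : ∀ {z : ℝ}, 0 < z → (z ^ (1 / q₀)) ^ q₀ = z ∧ (z ^ (1 / q₀)) ^ q = z ^ (q / q₀) :=
    fun hz => by
      rw [← rpow_mul hz.le, ← rpow_mul hz.le, one_div_mul_cancel hq₀.ne', rpow_one,
        one_div_mul_eq_div]
      exact ⟨rfl, rfl⟩
  refine ⟨A ^ (1 / q₀), u ^ (1 / q₀), 1, 0, rpow_le_rpow hu.le huA (by positivity), le_rfl,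
    zero_le_one, rpow_le_one hA0.le hA1 (by positivity), by positivity, ?_, ?_⟩
  · rw [(hpow hA0).1, (hpow hu).1, one_rpow, zero_rpow hq₀.ne']
    have : 0 < w₀ * u := by positivity
    linarith
  · rw [(hpow hA0).2, (hpow hu).2, one_rpow, zero_rpow hq.ne']
    have h3 : A ^ (q / q₀) ≤ A := by
      simpa using rpow_le_rpow_of_exponent_ge hA0 hA1 hr.le
    have h4 : w * u ^ (q / q₀) < w₀ / 2 * u := by
      have h5 := mul_lt_mul_of_pos_right h1 hu
      rw [mul_assoc, ← rpow_add_one hu.ne', sub_add_cancel] at h5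
      exact h5
    linarith

/-- Sharpness: if `(p,q)` fails one of the conditions `p ≤ p₀`, `q ≤ q₀`,
`q₀/p₀ ≤ q/p`, then there exist sequences `x, y`, each with at most two non-zero
entries, with `x ≶ y`, `‖x‖_{ℓ(p₀,q₀)} > ‖y‖_{ℓ(p₀,q₀)}` and
`‖x‖_{ℓ(p,q)} < ‖y‖_{ℓ(p,q)}`. -/
theorem statement9 (p₀ q₀ p q : ℝ) (hp₀ : 0 < p₀) (hq₀ : 0 < q₀)
    (hp : 0 < p) (hq : 0 < q)
    (hnot : ¬ (p ≤ p₀ ∧ q ≤ q₀ ∧ q₀ / p₀ ≤ q / p)) :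
    ∃ x y : ℕ → ℝ,
      {n : ℕ | x n ≠ 0}.Finite ∧ {n : ℕ | x n ≠ 0}.ncard ≤ 2 ∧
      {n : ℕ | y n ≠ 0}.Finite ∧ {n : ℕ | y n ≠ 0}.ncard ≤ 2 ∧
      SeqCross x y ∧
      seqLorentzNorm p₀ q₀ y < seqLorentzNorm p₀ q₀ x ∧
      seqLorentzNorm p q x < seqLorentzNorm p q y := by
  have hpair : ∃ a b c d : ℝ, b ≤ a ∧ 0 ≤ d ∧ d ≤ c ∧ a ≤ c ∧ d ≤ b ∧
      c ^ q₀ + 2 ^ (q₀ / p₀ - 1) * d ^ q₀ < a ^ q₀ + 2 ^ (q₀ / p₀ - 1) * b ^ q₀ ∧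
      a ^ q + 2 ^ (q / p - 1) * b ^ q < c ^ q + 2 ^ (q / p - 1) * d ^ q := by
    rcases lt_or_ge q₀ q with hqq | hqq
    · exact exists_pair_of_exponent_lt hq₀ hqq (by positivity)
    · have hratio : q / p < q₀ / p₀ := by
        by_contra! h
        refine hnot ⟨?_, hqq, h⟩
        rw [div_le_div_iff₀ hp₀ hp] at h
        nlinarith
      exact exists_pair_of_weight_lt hq₀ hq (by positivity)
        (rpow_lt_rpow_of_exponent_lt one_lt_two (by linarith))
  obtain ⟨a, b, c, d, hba, hd, hdc, hac, hdb, h₀, h⟩ := hpair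
  have hb : 0 ≤ b := hd.trans hdb
  exact ⟨pairSeq a b, pairSeq c d, finite_support_pairSeq a b, ncard_support_pairSeq_le a b,
    finite_support_pairSeq c d, ncard_support_pairSeq_le c d,
    seqCross_pairSeq hba hd hdc hac hdb,
    seqLorentzNorm_pairSeq_lt hq₀ hd hdc hb hba h₀,
    seqLorentzNorm_pairSeq_lt hq hb hba hd hdc h⟩
end

section
/- Let M be an Orlicz function on [0,∞) such that u ↦ M(√u) is also an Orlicz function. Then ‖g‖_{L_M} ≤ ‖f‖_{L_M}, where g(t) = |sin(πt)/(πt)| and f(t) = e^{−πt²/2} for t ∈ (0,∞), and ‖·‖_{L_M} is the Luxemburg norm. -/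
open MeasureTheory Set Real Filter
open scoped ENNReal NNReal

/-- An Orlicz function on `[0,∞)`: continuous, convex, increasing, `M(0) = 0`
and `M(u) → ∞` as `u → ∞`. -/
def IsOrlicz (M : ℝ → ℝ) : Prop :=
  ContinuousOn M (Set.Ici 0) ∧ ConvexOn ℝ (Set.Ici 0) M ∧ StrictMonoOn M (Set.Ici 0) ∧
    M 0 = 0 ∧ Filter.Tendsto M Filter.atTop Filter.atTop

/-- The Luxemburg norm `‖h‖_{L_M} = inf{λ > 0 : ∫₀^∞ M(|h(s)|/λ) ds ≤ 1}`. -/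
noncomputable def luxNorm (M : ℝ → ℝ) (h : ℝ → ℝ) : ℝ :=
  sInf {lam : ℝ | 0 < lam ∧
    (∫⁻ s in Set.Ioi (0:ℝ), ENNReal.ofReal (M (|h s| / lam))) ≤ 1}

lemma lintegral_Ioi_meas_lt {α : Type*} [MeasurableSpace α] {μ : Measure α} {u : α → ℝ}
    (hu : ∀ a, 0 ≤ u a) (hum : Measurable u) {c : ℝ} (hc : 0 ≤ c) :
    ∫⁻ s in Ioi c, μ {a | s < u a} = ∫⁻ a, ENNReal.ofReal (u a - c) ∂μ := by
  have hint : ∀ t : ℝ, IntervalIntegrable ((Ioi c).indicator fun _ => (1 : ℝ)) volume 0 t := by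
    intro t
    exact ⟨(integrable_const _).indicator measurableSet_Ioi,
      (integrable_const _).indicator measurableSet_Ioi⟩
  have key := lintegral_comp_eq_lintegral_meas_lt_mul (f := u)
    (g := (Ioi c).indicator fun _ => (1 : ℝ)) μ (Eventually.of_forall hu) hum.aemeasurable
    (fun t _ => hint t)
    (Eventually.of_forall fun t => indicator_nonneg (fun _ _ => zero_le_one) t)
  have h1 : ∀ a, ENNReal.ofReal (∫ t in (0 : ℝ)..u a, (Ioi c).indicator (fun _ => (1 : ℝ)) t) =
      ENNReal.ofReal (u a - c) := by
    intro a
    rw [intervalIntegral.integral_of_le (hu a), setIntegral_indicator measurableSet_Ioi,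
      Ioc_inter_Ioi, max_eq_right hc]
    rcases le_total c (u a) with h | h
    · simp [h]
    · simp [h]
  simp_rw [h1] at key
  rw [key, ← lintegral_indicator measurableSet_Ioi, ← lintegral_indicator measurableSet_Ioi]
  congr 1
  ext s
  by_cases hs : c < s
  · simp [hs, hc.trans_lt hs]
  · simp [hs, indicator_apply]

lemma ConvexOn.exists_monotone_integral_eq {N : ℝ → ℝ} (hN : ConvexOn ℝ (Ici 0) N)
    (hc : ContinuousOn N (Ici 0)) (hm : MonotoneOn N (Ici 0)) (h0 : N 0 = 0) :
    ∃ D : ℝ → ℝ, Monotone D ∧ (∀ s ≤ 0, D s = 0) ∧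
      ∀ u, 0 ≤ u → ∫ s in (0 : ℝ)..u, D s = N u := by
  have hint : interior (Ici (0 : ℝ)) = Ioi 0 := interior_Ici
  have hmono := hN.monotoneOn_rightDeriv
  rw [hint] at hmono
  have hd : ∀ s, 0 < s → HasDerivWithinAt N (derivWithin N (Ioi s) s) (Ioi s) s := fun s hs =>
    hN.hasDerivWithinAt_rightDeriv_of_mem_interior (by rw [hint]; exact hs)
  have hnn : ∀ s, 0 < s → 0 ≤ derivWithin N (Ioi s) s := by
    intro s hs
    have := (hasDerivWithinAt_iff_tendsto_slope' self_notMem_Ioi).mp (hd s hs)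
    refine ge_of_tendsto this ?_
    filter_upwards [self_mem_nhdsWithin] with y hy
    have hy' : s < y := hy
    rw [slope_def_field]
    exact div_nonneg (sub_nonneg.2 (hm hs.le (hs.le.trans hy'.le) hy'.le)) (sub_nonneg.2 hy'.le)
  let D : ℝ → ℝ := fun s => if 0 < s then derivWithin N (Ioi s) s else 0
  have hD : ∀ s, 0 < s → D s = derivWithin N (Ioi s) s := fun s hs => if_pos hs
  have hD0 : ∀ s ≤ 0, D s = 0 := fun s hs => if_neg (not_lt.2 hs)
  have hDm : Monotone D := by
    intro s t hst
    rcases le_or_gt s 0 with hs | hs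
    · rw [hD0 s hs]
      rcases le_or_gt t 0 with ht | ht
      · rw [hD0 t ht]
      · rw [hD t ht]; exact hnn t ht
    · have ht := hs.trans_le hst
      rw [hD s hs, hD t ht]
      exact hmono hs ht hst
  refine ⟨D, hDm, hD0, fun u hu => ?_⟩
  rw [intervalIntegral.integral_eq_sub_of_hasDeriv_right (f := N), h0, sub_zero]
  · rw [uIcc_of_le hu]; exact hc.mono Icc_subset_Ici_self
  · intro x hx
    rw [min_eq_left hu] at hx
    rw [hD x hx.1]
    exact hd x hx.1
  · exact hDm.intervalIntegrable

lemma ConvexOn.lintegral_comp_le {α : Type*} [MeasurableSpace α] {μ : Measure α} {u v : α → ℝ}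
    (hu : ∀ a, 0 ≤ u a) (hv : ∀ a, 0 ≤ v a) (hum : Measurable u) (hvm : Measurable v)
    {N : ℝ → ℝ} (hN : ConvexOn ℝ (Ici 0) N)
    (hc : ContinuousOn N (Ici 0)) (hm : MonotoneOn N (Ici 0)) (h0 : N 0 = 0)
    (h : ∀ c, 0 ≤ c → ∫⁻ a, ENNReal.ofReal (u a - c) ∂μ ≤ ∫⁻ a, ENNReal.ofReal (v a - c) ∂μ) :
    ∫⁻ a, ENNReal.ofReal (N (u a)) ∂μ ≤ ∫⁻ a, ENNReal.ofReal (N (v a)) ∂μ := by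
  obtain ⟨D, hDm, hD0, hDN⟩ := hN.exists_monotone_integral_eq hc hm h0
  have hDnn : ∀ s, 0 ≤ D s := by
    intro s
    rcases le_total s 0 with hs | hs
    · rw [hD0 s hs]
    · rw [← hD0 0 le_rfl]; exact hDm hs
  have hmeas : ∀ w : α → ℝ, Measurable fun s : ℝ => μ {a | s < w a} := fun w =>
    Antitone.measurable fun s t hst => measure_mono fun a (ha : t < w a) => hst.trans_lt ha
  let ν : (α → ℝ) → Measure ℝ := fun w =>
    (volume.restrict (Ioi 0)).withDensity fun s => μ {a | s < w a}
  have key : ∀ w : α → ℝ, (∀ a, 0 ≤ w a) → Measurable w →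
      ∫⁻ a, ENNReal.ofReal (N (w a)) ∂μ = ∫⁻ r in Ioi 0, ν w {s | r < D s} := by
    intro w hw hwm
    rw [← lintegral_eq_lintegral_meas_lt _ (Eventually.of_forall hDnn) hDm.measurable.aemeasurable,
      lintegral_withDensity_eq_lintegral_mul _ (hmeas w) hDm.measurable.ennreal_ofReal]
    have := lintegral_comp_eq_lintegral_meas_lt_mul (f := w) (g := D) μ (Eventually.of_forall hw)
      hwm.aemeasurable (fun t _ => hDm.intervalIntegrable) (Eventually.of_forall hDnn)
    simp_rw [hDN _ (hw _)] at this
    exact this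
  have hIoi : ∀ w : α → ℝ, (∀ a, 0 ≤ w a) → Measurable w → ∀ c, 0 ≤ c →
      ν w (Ioi c) = ∫⁻ a, ENNReal.ofReal (w a - c) ∂μ := by
    intro w hw hwm c hc
    rw [withDensity_apply _ measurableSet_Ioi, Measure.restrict_restrict measurableSet_Ioi,
      Ioi_inter_Ioi, max_eq_left hc, lintegral_Ioi_meas_lt hw hwm hc]
  rw [key u hu hum, key v hv hvm]
  refine setLIntegral_mono' measurableSet_Ioi fun r hr => ?_
  set U := {s | r < D s}
  have hUpos : ∀ s ∈ U, 0 < s := by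
    intro s hs
    by_contra hs'
    have h1 : r < D s := hs
    rw [hD0 s (not_lt.1 hs')] at h1
    exact lt_asymm h1 hr
  rcases U.eq_empty_or_nonempty with hE | hne
  · simp [hE]
  have hbdd : BddBelow U := ⟨0, fun s hs => (hUpos s hs).le⟩
  have hc0 : 0 ≤ sInf U := le_csInf hne fun s hs => (hUpos s hs).le
  have hsub : U ⊆ Ici (sInf U) := fun s hs => csInf_le hbdd hs
  have hsup : Ioi (sInf U) ⊆ U := by
    intro s hs
    obtain ⟨t, ht, hts⟩ := (csInf_lt_iff hbdd hne).1 hs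
    exact lt_of_lt_of_le (show r < D t from ht) (hDm hts.le)
  calc ν u U ≤ ν u (Ici (sInf U)) := measure_mono hsub
    _ = ν u (Ioi (sInf U)) := by
      have hac : ν u ≪ volume :=
        (withDensity_absolutelyContinuous _ _).trans Measure.restrict_le_self.absolutelyContinuous
      exact (measure_congr (hac.ae_le Ioi_ae_eq_Ici)).symm
    _ ≤ ν v (Ioi (sInf U)) := by
      rw [hIoi u hu hum _ hc0, hIoi v hv hvm _ hc0]; exact h _ hc0
    _ ≤ ν v U := measure_mono hsup

lemma sin_pi_mul_div_le_exp {x : ℝ} (h0 : 0 < x) (h1 : x ≤ 1) :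
    Real.sin (π * x) / (π * x) ≤ Real.exp (-(π * x ^ 2) / 2) := by
  have hpx : 0 < π * x := mul_pos pi_pos h0
  have hlim := Real.tendsto_euler_sin_prod x
  have hsum : Tendsto (fun n : ℕ => ∑ j ∈ Finset.range n, (1 : ℝ) / ((j : ℝ) + 1) ^ 2) atTop
      (nhds (π ^ 2 / 6)) := by
    have h := (hasSum_nat_add_iff' 1).2 hasSum_zeta_two
    simpa using h.tendsto_sum_nat
  have hexp : Tendsto (fun n : ℕ => π * x *
      Real.exp (-x ^ 2 * ∑ j ∈ Finset.range n, (1 : ℝ) / ((j : ℝ) + 1) ^ 2)) atTop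
      (nhds (π * x * Real.exp (-x ^ 2 * (π ^ 2 / 6)))) :=
    ((Real.continuous_exp.tendsto _).comp (hsum.const_mul _)).const_mul _
  have hle : Real.sin (π * x) ≤ π * x * Real.exp (-x ^ 2 * (π ^ 2 / 6)) := by
    refine le_of_tendsto_of_tendsto' hlim hexp fun n => ?_
    refine mul_le_mul_of_nonneg_left ?_ hpx.le
    rw [Finset.mul_sum, Real.exp_sum]
    refine Finset.prod_le_prod (fun j _ => ?_) fun j _ => ?_
    · rw [sub_nonneg, div_le_one (by positivity)]
      have : (0 : ℝ) ≤ j := j.cast_nonneg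
      exact pow_le_pow_left₀ h0.le (by linarith) 2
    · have := Real.add_one_le_exp (-x ^ 2 * (1 / ((j : ℝ) + 1) ^ 2))
      refine le_trans (le_of_eq ?_) this
      ring
  rw [div_le_iff₀ hpx, mul_comm (rexp _)]
  refine hle.trans (mul_le_mul_of_nonneg_left (Real.exp_le_exp.2 ?_) hpx.le)
  nlinarith [mul_nonneg (mul_nonneg pi_pos.le (sub_nonneg.2 pi_gt_three.le)) (sq_nonneg x)]

lemma hasSum_sin_sq_div_sq {a : ℝ} (h0 : 0 ≤ a) (h1 : a ≤ 1) :
    HasSum (fun n : ℕ => (Real.sin (π * (n * a)) / (π * n)) ^ 2) ((a - a ^ 2) / 2) := by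
  have hb : (Polynomial.map (algebraMap ℚ ℝ) (Polynomial.bernoulli 2)).eval a =
      a ^ 2 - a + 1 / 6 := by
    simp [Polynomial.bernoulli_def, Finset.sum_range_succ, bernoulli_one, bernoulli_two,
      Polynomial.map_monomial]
    ring
  have hc := hasSum_one_div_nat_pow_mul_cos one_ne_zero (x := a) ⟨h0, h1⟩
  have h := (hasSum_zeta_two.sub hc).mul_left (1 / (2 * π ^ 2))
  simp only [mul_one, hb] at h
  convert! h using 1
  · ext n
    rw [div_pow, Real.sin_sq_eq_half_sub, show 2 * (π * (n * a)) = 2 * π * n * a by ring]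
    ring
  · simp [Nat.factorial]
    field_simp
    ring

lemma lintegral_sin_sq_div_sq_le :
    ∫⁻ t in Ioi (0 : ℝ), ENNReal.ofReal ((Real.sin (π * t) / (π * t)) ^ 2) ≤
      ENNReal.ofReal (1 / 2) := by
  set g : ℝ → ℝ := fun t => (Real.sin (π * t) / (π * t)) ^ 2 with hg
  let a : ℕ → ℝ := fun n => 1 / ((n : ℝ) + 1)
  have ha : ∀ n, 0 < a n := fun n => by positivity
  have ha1 : ∀ n, a n ≤ 1 := fun n => by
    rw [div_le_one (by positivity)]; linarith [(n.cast_nonneg : (0 : ℝ) ≤ n)]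
  have halim : Tendsto a atTop (nhds 0) := tendsto_one_div_add_atTop_nhds_zero_nat
  let φ : ℕ → ℝ → ℝ := fun n t => a n * ⌈t / a n⌉₊
  have hgm : Measurable g := by fun_prop
  have hφm : ∀ n, Measurable (φ n) := fun n => by
    refine Measurable.const_mul ?_ _
    exact (measurable_from_nat (f := fun k : ℕ => (k : ℝ))).comp
      (Nat.measurable_ceil.comp (measurable_id.div_const _))
  have hφlim : ∀ t, 0 < t → Tendsto (fun n => φ n t) atTop (nhds t) := by
    intro t ht
    refine tendsto_of_tendsto_of_tendsto_of_le_of_le (g := fun _ => t) (h := fun n => t + a n)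
      tendsto_const_nhds ?_ ?_ ?_
    · simpa using halim.const_add t
    · intro n
      have := Nat.le_ceil (t / a n)
      rw [div_le_iff₀ (ha n)] at this
      simpa [φ, mul_comm] using this
    · intro n
      have := (Nat.ceil_lt_add_one (div_pos ht (ha n)).le).le
      have := mul_le_mul_of_nonneg_left this (ha n).le
      rw [mul_add, mul_div_cancel₀ _ (ha n).ne', mul_one] at this
      exact this
  have hval : ∀ n, ∫⁻ t in Ioi (0 : ℝ), ENNReal.ofReal (g (φ n t)) ≤ ENNReal.ofReal (1 / 2) := by
    intro n
    have hU : Ioi (0 : ℝ) ⊆ ⋃ k : ℕ, Ioc (a n * k) (a n * (k + 1)) := by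
      intro t ht
      have ht : 0 < t := ht
      have hpos : 0 < ⌈t / a n⌉₊ := Nat.ceil_pos.2 (div_pos ht (ha n))
      refine mem_iUnion.2 ⟨⌈t / a n⌉₊ - 1, ?_, ?_⟩
      · rw [← lt_div_iff₀' (ha n), Nat.cast_pred hpos]
        linarith [Nat.ceil_lt_add_one (div_pos ht (ha n)).le]
      · rw [← div_le_iff₀' (ha n), Nat.cast_pred hpos]
        linarith [Nat.le_ceil (t / a n)]
    have hs : HasSum (fun k : ℕ => a n * g (a n * (k + 1))) ((1 - a n) / 2) := by
      have h := hasSum_sin_sq_div_sq (ha n).le (ha1 n)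
      have h' := (hasSum_nat_add_iff' 1).2 h
      have h'' := h'.mul_left (1 / a n)
      have hne := (ha n).ne'
      convert! h'' using 1
      · ext k
        simp only [hg]
        push_cast
        rw [show ((k : ℝ) + 1) * a n = a n * (k + 1) by ring]
        field_simp
      · simp
        field_simp
    calc ∫⁻ t in Ioi (0 : ℝ), ENNReal.ofReal (g (φ n t))
        ≤ ∫⁻ t in ⋃ k : ℕ, Ioc (a n * k) (a n * (k + 1)), ENNReal.ofReal (g (φ n t)) :=
          lintegral_mono_set hU
      _ ≤ ∑' k : ℕ, ∫⁻ t in Ioc (a n * k) (a n * (k + 1)), ENNReal.ofReal (g (φ n t)) :=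
          lintegral_iUnion_le _ _
      _ = ∑' k : ℕ, ENNReal.ofReal (a n * g (a n * (k + 1))) := by
          congr 1
          ext k
          rw [setLIntegral_congr_fun (g := fun _ => ENNReal.ofReal (g (a n * (k + 1))))
            measurableSet_Ioc, setLIntegral_const, Real.volume_Ioc,
            ENNReal.ofReal_mul (ha n).le, mul_comm]
          · congr 2; ring
          · intro t ht
            have : ⌈t / a n⌉₊ = k + 1 := by
              rw [Nat.ceil_eq_iff (by simp)]
              push_cast
              rw [lt_div_iff₀' (ha n), div_le_iff₀' (ha n)]
              simpa using ht
            simp [φ, this]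
      _ = ENNReal.ofReal ((1 - a n) / 2) := by
          rw [← hs.tsum_eq, ENNReal.ofReal_tsum_of_nonneg _ hs.summable]
          exact fun k => mul_nonneg (ha n).le (sq_nonneg _)
      _ ≤ ENNReal.ofReal (1 / 2) := ENNReal.ofReal_le_ofReal (by linarith [ha n])
  calc ∫⁻ t in Ioi (0 : ℝ), ENNReal.ofReal (g t)
      = ∫⁻ t in Ioi (0 : ℝ), liminf (fun n => ENNReal.ofReal (g (φ n t))) atTop := by
        refine setLIntegral_congr_fun measurableSet_Ioi fun t ht => ?_
        have ht : 0 < t := ht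
        have hgc : ContinuousAt g t := by
          refine ContinuousAt.pow (ContinuousAt.div (by fun_prop) (by fun_prop) ?_) 2
          positivity
        exact ((ENNReal.tendsto_ofReal ((hgc.tendsto).comp (hφlim t ht))).liminf_eq).symm
    _ ≤ liminf (fun n => ∫⁻ t in Ioi (0 : ℝ), ENNReal.ofReal (g (φ n t))) atTop :=
        lintegral_liminf_le fun n => (hgm.comp (hφm n)).ennreal_ofReal
    _ ≤ ENNReal.ofReal (1 / 2) :=
        (liminf_le_liminf (Eventually.of_forall hval)).trans_eq (by simp)

/-- A lower bound for the truncated integral; `s = √c`. -/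
lemma ofReal_le_lintegral_min_sin_sq {s : ℝ} (hs : 0 < s) :
    ENNReal.ofReal (s / π - s ^ 2 / (4 * π)) ≤
      ∫⁻ t in Ioi (0 : ℝ), ENNReal.ofReal (min ((Real.sin (π * t) / (π * t)) ^ 2) (s ^ 2)) := by
  have hpi := pi_pos
  set k : ℝ → ℝ := fun t => min ((Real.sin (π * t) / (π * t)) ^ 2) (s ^ 2) with hk
  have hkm : Measurable k := by fun_prop
  have hk0 : ∀ t, 0 ≤ k t := fun t => le_min (sq_nonneg _) (sq_nonneg _)
  have hki : ∀ a b : ℝ, IntegrableOn k (Icc a b) := fun a b => by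
    refine Measure.integrableOn_of_bounded (M := s ^ 2) (by simp) hkm.aestronglyMeasurable
      (Eventually.of_forall fun t => ?_)
    rw [Real.norm_of_nonneg (hk0 t)]
    exact min_le_right _ _
  have hkii : ∀ a b : ℝ, IntervalIntegrable k volume a b := fun a b =>
    ⟨(hki a b).mono_set Ioc_subset_Icc_self, (hki b a).mono_set Ioc_subset_Icc_self⟩
  set R : ℝ := 1 / (π * s) with hR
  have hR0 : 0 < R := by positivity
  let W : ℝ → ℝ := fun t => s ^ 2 * (t / 2 - Real.sin (2 * π * t) / (4 * π))
  let V : ℝ → ℝ := fun t => -(1 / (2 * π ^ 2)) * t⁻¹ -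
    (1 / (4 * π ^ 3)) * (Real.sin (2 * π * t) * t⁻¹ ^ 2) + (1 / (4 * π ^ 3)) * t⁻¹ ^ 2
  have hsin : ∀ t, HasDerivAt (fun t => Real.sin (2 * π * t))
      (Real.cos (2 * π * t) * (2 * π)) t := fun t => by
    simpa using ((hasDerivAt_id t).const_mul (2 * π)).sin
  have hhalf : ∀ t, Real.sin (π * t) ^ 2 = 1 / 2 - Real.cos (2 * π * t) / 2 := fun t => by
    rw [Real.sin_sq_eq_half_sub, ← mul_assoc]
  have hW : ∀ t, HasDerivAt W (s ^ 2 * Real.sin (π * t) ^ 2) t := fun t => by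
    have := (((hasDerivAt_id t).div_const 2).sub ((hsin t).div_const (4 * π))).const_mul (s ^ 2)
    convert! this using 1
    rw [hhalf]
    field_simp
    ring
  have hV : ∀ t, 0 < t → HasDerivAt V ((Real.sin (π * t) / (π * t)) ^ 2 -
      (1 - Real.sin (2 * π * t)) / (2 * π ^ 3 * t ^ 3)) t := fun t ht => by
    have hi := hasDerivAt_inv ht.ne'
    have hi2 := hi.pow 2
    have := ((hi.const_mul (-(1 / (2 * π ^ 2)))).sub
      (((hsin t).mul hi2).const_mul (1 / (4 * π ^ 3)))).add (hi2.const_mul (1 / (4 * π ^ 3)))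
    convert! this using 1
    rw [div_pow, hhalf]
    simp
    field_simp
    ring
  have h1 : W R - W 0 ≤ ∫ t in (0 : ℝ)..R, k t := by
    refine intervalIntegral.sub_le_integral_of_hasDeriv_right_of_le hR0.le
      (fun t _ => (hW t).continuousAt.continuousWithinAt) (fun t _ => (hW t).hasDerivWithinAt)
      (hki _ _) fun t ht => le_min ?_ ?_
    · have ht0 : 0 < t := ht.1
      have htR : t < R := ht.2
      rw [hR, lt_div_iff₀ (by positivity)] at htR
      have h2 : s ^ 2 * (π * t) ^ 2 ≤ 1 := by
        rw [← mul_pow]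
        exact pow_le_one₀ (by positivity) (by linarith)
      rw [div_pow, le_div_iff₀ (by positivity)]
      nlinarith [sq_nonneg (Real.sin (π * t))]
    · exact mul_le_of_le_one_right (sq_nonneg _) (Real.sin_sq_le_one _)
  have h2 : ∀ B, R ≤ B → V B - V R ≤ ∫ t in R..B, k t := by
    intro B hB
    refine intervalIntegral.sub_le_integral_of_hasDeriv_right_of_le hB
      (fun t ht => (hV t (hR0.trans_le ht.1)).continuousAt.continuousWithinAt)
      (fun t ht => (hV t (hR0.trans ht.1)).hasDerivWithinAt) (hki _ _) fun t ht => ?_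
    have ht0 : 0 < t := hR0.trans ht.1
    have htR : R < t := ht.1
    rw [hR, div_lt_iff₀ (by positivity)] at htR
    have h3 : (Real.sin (π * t) / (π * t)) ^ 2 ≤ s ^ 2 := by
      rw [div_pow, div_le_iff₀ (by positivity), ← mul_pow]
      refine (Real.sin_sq_le_one _).trans (one_le_pow₀ ?_)
      linarith
    simp only [hk]
    rw [min_eq_left h3]
    have : 0 ≤ (1 - Real.sin (2 * π * t)) / (2 * π ^ 3 * t ^ 3) :=
      div_nonneg (sub_nonneg.2 (Real.sin_le_one _)) (by positivity)
    linarith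
  have hVlim : Tendsto V atTop (nhds 0) := by
    have hi : Tendsto (fun t : ℝ => t⁻¹) atTop (nhds 0) := tendsto_inv_atTop_zero
    have hi2 : Tendsto (fun t : ℝ => t⁻¹ ^ 2) atTop (nhds 0) := by simpa using hi.pow 2
    have hsi : Tendsto (fun t : ℝ => Real.sin (2 * π * t) * t⁻¹ ^ 2) atTop (nhds 0) := by
      refine squeeze_zero_norm (fun t => ?_) hi2
      rw [norm_mul, Real.norm_of_nonneg (sq_nonneg (t⁻¹))]
      exact mul_le_of_le_one_left (sq_nonneg _) (Real.abs_sin_le_one _)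
    have h := ((hi.const_mul (-(1 / (2 * π ^ 2)))).sub
      (hsi.const_mul (1 / (4 * π ^ 3)))).add (hi2.const_mul (1 / (4 * π ^ 3)))
    simp only [mul_zero, sub_zero, add_zero] at h
    exact h
  have hlim : Tendsto (fun B => ENNReal.ofReal (W R - W 0 + (V B - V R))) atTop
      (nhds (ENNReal.ofReal (W R - W 0 + (0 - V R)))) :=
    ENNReal.tendsto_ofReal ((hVlim.sub_const _).const_add _)
  have hval : W R - W 0 + (0 - V R) = s / π - s ^ 2 / (4 * π) := by
    simp only [W, V, hR]
    simp
    field_simp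
    ring
  rw [← hval]
  refine le_of_tendsto hlim ?_
  filter_upwards [eventually_ge_atTop R] with B hB
  calc ENNReal.ofReal (W R - W 0 + (V B - V R))
      ≤ ENNReal.ofReal (∫ t in (0 : ℝ)..B, k t) := by
        refine ENNReal.ofReal_le_ofReal ?_
        rw [← intervalIntegral.integral_add_adjacent_intervals (hkii 0 R) (hkii R B)]
        exact add_le_add h1 (h2 B hB)
    _ = ∫⁻ t in Ioc 0 B, ENNReal.ofReal (k t) := by
        rw [intervalIntegral.integral_of_le (hR0.le.trans hB),
          ofReal_integral_eq_lintegral_ofReal (hkii 0 B).1 (Eventually.of_forall hk0)]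
    _ ≤ ∫⁻ t in Ioi (0 : ℝ), ENNReal.ofReal (k t) := lintegral_mono_set Ioc_subset_Ioi_self

lemma lintegral_gaussian_Ioi_zero :
    ∫⁻ t in Ioi (0 : ℝ), ENNReal.ofReal (Real.exp (-(π * t ^ 2))) = ENNReal.ofReal (1 / 2) := by
  have h := integral_gaussian_Ioi π
  have hi : Integrable (fun t : ℝ => Real.exp (-π * t ^ 2)) := integrable_exp_neg_mul_sq pi_pos
  rw [div_self pi_ne_zero, Real.sqrt_one] at h
  simp_rw [← neg_mul]
  rw [← h, ofReal_integral_eq_lintegral_ofReal hi.integrableOn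
    (Eventually.of_forall fun t => (Real.exp_pos _).le)]

lemma lintegral_gaussian_Ioi_le {T : ℝ} (hT : 0 < T) :
    ∫⁻ t in Ioi T, ENNReal.ofReal (Real.exp (-(π * t ^ 2))) ≤
      ENNReal.ofReal (Real.exp (-(π * T ^ 2)) / (2 * π * T)) := by
  have hpi := pi_pos
  let G : ℝ → ℝ := fun t => -(1 / (2 * π * T)) * Real.exp (-(π * t ^ 2))
  have hG : ∀ t ∈ Ici T, HasDerivAt G (t / T * Real.exp (-(π * t ^ 2))) t := fun t _ => by
    have := ((((hasDerivAt_id t).pow 2).const_mul π).neg.exp).const_mul (-(1 / (2 * π * T)))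
    convert! this using 1
    simp
    field_simp
  have hnn : ∀ t ∈ Ioi T, 0 ≤ t / T * Real.exp (-(π * t ^ 2)) := fun t ht =>
    mul_nonneg (div_nonneg (hT.trans ht).le hT.le) (Real.exp_pos _).le
  have hlim : Tendsto G atTop (nhds 0) := by
    have : Tendsto (fun t : ℝ => Real.exp (-(π * t ^ 2))) atTop (nhds 0) :=
      Real.tendsto_exp_neg_atTop_nhds_zero.comp
        ((tendsto_pow_atTop two_ne_zero).const_mul_atTop hpi)
    simpa [G] using this.const_mul (-(1 / (2 * π * T)))
  have hint := integrableOn_Ioi_deriv_of_nonneg' hG hnn hlim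
  have hval := integral_Ioi_of_hasDerivAt_of_nonneg' hG hnn hlim
  have hval' : Real.exp (-(π * T ^ 2)) / (2 * π * T) =
      ∫ t in Ioi T, t / T * Real.exp (-(π * t ^ 2)) := by
    rw [hval]; simp only [G]; ring
  rw [hval', ofReal_integral_eq_lintegral_ofReal hint
    ((ae_restrict_iff' measurableSet_Ioi).2 (Eventually.of_forall hnn))]
  refine setLIntegral_mono' measurableSet_Ioi fun t ht => ENNReal.ofReal_le_ofReal ?_
  exact le_mul_of_one_le_left (Real.exp_pos _).le ((one_le_div hT).2 (le_of_lt ht))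

lemma lintegral_min_gaussian_le {T c : ℝ} (hT : 0 < T) (hc : c = Real.exp (-(π * T ^ 2))) :
    ∫⁻ t in Ioi (0 : ℝ), ENNReal.ofReal (min (Real.exp (-(π * t ^ 2))) c) ≤
      ENNReal.ofReal (c * (T + 1 / (2 * π * T))) := by
  have hpi := pi_pos
  have hc0 : 0 < c := hc ▸ Real.exp_pos _
  rw [← Ioc_union_Ioi_eq_Ioi hT.le]
  refine (lintegral_union_le _ _ _).trans ?_
  rw [mul_add, ENNReal.ofReal_add (by positivity) (by positivity)]
  refine add_le_add ?_ ?_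
  · refine (lintegral_mono fun t => ENNReal.ofReal_le_ofReal (min_le_right _ _)).trans ?_
    rw [setLIntegral_const, Real.volume_Ioc, sub_zero, ENNReal.ofReal_mul hc0.le]
  · refine (lintegral_mono fun t => ENNReal.ofReal_le_ofReal (min_le_left _ _)).trans ?_
    rw [mul_one_div, hc]
    exact lintegral_gaussian_Ioi_le hT

lemma min_bound_comparison {s T : ℝ} (hs : 0 < s) (hs4 : s ≤ 1 / 4) (hT : 0 < T)
    (hsT : s ^ 2 = Real.exp (-(π * T ^ 2))) :
    s ^ 2 * (T + 1 / (2 * π * T)) ≤ s / π - s ^ 2 / (4 * π) := by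
  have hpi := pi_pos
  have hpl := pi_gt_d2
  have hpu := pi_lt_d2
  set L := Real.log (1 / (4 * s)) with hL
  have hL0 : 0 ≤ L := Real.log_nonneg (by rw [le_div_iff₀ (by positivity)]; linarith)
  have hexpL : Real.exp L = 1 / (4 * s) := Real.exp_log (by positivity)
  have hLs : 4 * s * (1 + L) ≤ 1 := by
    have h := Real.add_one_le_exp L
    rw [hexpL, le_div_iff₀ (by positivity)] at h
    linarith
  have hT2 : π * T ^ 2 = 2 * L + 4 * Real.log 2 := by
    have h1 : Real.log (s ^ 2) = -(π * T ^ 2) := by rw [hsT, Real.log_exp]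
    have h2 : L = -(2 * Real.log 2 + Real.log s) := by
      rw [hL, one_div, Real.log_inv, Real.log_mul (by norm_num) hs.ne',
        show (4 : ℝ) = 2 ^ 2 by norm_num, Real.log_pow]
      push_cast; ring
    rw [Real.log_pow] at h1
    push_cast at h1
    linarith
  have hl1 := Real.log_two_gt_d9
  have hl2 := Real.log_two_lt_d9
  have hT93 : 0.93 ≤ T := by
    by_contra h
    push Not at h
    nlinarith
  have hpT : π * T ≤ (2 * L + 4 * Real.log 2) / (2 * 0.94) + 0.94 / 2 * π := by
    rw [← hT2]
    have h := mul_nonneg hpi.le (sq_nonneg (T - 0.94))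
    have e : π * T ^ 2 / (2 * 0.94) + 0.94 / 2 * π - π * T = π * (T - 0.94) ^ 2 / 1.88 := by
      ring
    have h' : 0 ≤ π * (T - 0.94) ^ 2 / 1.88 := div_nonneg h (by norm_num)
    linarith
  have hTinv : 1 / (2 * T) ≤ 0.54 := by
    rw [div_le_iff₀ (by positivity)]; linarith
  have hmain : 1 / 4 + π * T + 1 / (2 * T) ≤ 4 * (1 + L) := by
    norm_num at hpT ⊢
    norm_num at hTinv
    linarith
  have hfin : s * (1 / 4 + π * T + 1 / (2 * T)) ≤ 1 := by nlinarith
  have e : s / π - s ^ 2 / (4 * π) - s ^ 2 * (T + 1 / (2 * π * T)) =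
      s / π * (1 - s * (1 / 4 + π * T + 1 / (2 * T))) := by
    field_simp
    ring
  have : 0 ≤ s / π * (1 - s * (1 / 4 + π * T + 1 / (2 * T))) :=
    mul_nonneg (by positivity) (by linarith)
  linarith

lemma sin_sq_div_sq_le_of_one_le {t : ℝ} (ht : 1 ≤ t) :
    (Real.sin (π * t) / (π * t)) ^ 2 ≤ 1 / 16 := by
  have hpi := pi_pos
  have hpt : 0 < π * t := by positivity
  have h : |Real.sin (π * t)| ≤ π * t / 4 := by
    rcases le_total (4 / π) t with h4 | h4
    · rw [div_le_iff₀' hpi] at h4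
      linarith [Real.abs_sin_le_one (π * t)]
    · rw [le_div_iff₀' hpi] at h4
      have h1 : Real.sin (π * t) = -Real.sin (π * (t - 1)) := by
        rw [mul_sub, mul_one, Real.sin_sub_pi, neg_neg]
      have h2 : |Real.sin (π * (t - 1))| ≤ |π * (t - 1)| := Real.abs_sin_le_abs
      rw [h1, abs_neg]
      rw [abs_of_nonneg (mul_nonneg hpi.le (sub_nonneg.2 ht))] at h2
      linarith [pi_gt_three]
  have h' : |Real.sin (π * t) / (π * t)| ≤ 1 / 4 := by
    rw [abs_div, abs_of_pos hpt, div_le_iff₀ hpt]; linarith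
  rw [← sq_abs]
  calc |Real.sin (π * t) / (π * t)| ^ 2 ≤ (1 / 4) ^ 2 := pow_le_pow_left₀ (abs_nonneg _) h' 2
    _ = 1 / 16 := by norm_num

lemma ofReal_sub_add_ofReal_min {x c : ℝ} (hc : 0 ≤ c) :
    ENNReal.ofReal (x - c) + ENNReal.ofReal (min x c) = ENNReal.ofReal x := by
  rcases le_total x c with h | h
  · rw [ENNReal.ofReal_of_nonpos (sub_nonpos.2 h), min_eq_left h, zero_add]
  · rw [min_eq_right h, ← ENNReal.ofReal_add (sub_nonneg.2 h) hc, sub_add_cancel]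

lemma lintegral_sin_sq_sub_le_gaussian_sub {c : ℝ} (hc : 0 ≤ c) :
    ∫⁻ t in Ioi (0 : ℝ), ENNReal.ofReal ((Real.sin (π * t) / (π * t)) ^ 2 - c) ≤
      ∫⁻ t in Ioi (0 : ℝ), ENNReal.ofReal (Real.exp (-(π * t ^ 2)) - c) := by
  have hpi := pi_pos
  rcases le_or_gt (1 / 16) c with h16 | h16
  · refine setLIntegral_mono' measurableSet_Ioi fun t ht => ?_
    have ht : 0 < t := ht
    rcases le_total 1 t with h1 | h1
    · rw [ENNReal.ofReal_of_nonpos (sub_nonpos.2 ((sin_sq_div_sq_le_of_one_le h1).trans h16))]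
      exact zero_le
    · refine ENNReal.ofReal_le_ofReal (sub_le_sub_right ?_ c)
      have h0 : 0 ≤ Real.sin (π * t) / (π * t) :=
        div_nonneg (Real.sin_nonneg_of_nonneg_of_le_pi (by positivity) (by nlinarith))
          (by positivity)
      refine (pow_le_pow_left₀ h0 (sin_pi_mul_div_le_exp ht h1) 2).trans_eq ?_
      rw [← Real.exp_nat_mul]
      congr 1
      push_cast
      ring
  rcases hc.eq_or_lt with rfl | hc0
  · simp only [sub_zero]
    exact lintegral_sin_sq_div_sq_le.trans_eq lintegral_gaussian_Ioi_zero.symm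
  set s := √c
  have hs0 : 0 < s := Real.sqrt_pos.2 hc0
  have hsc : s ^ 2 = c := Real.sq_sqrt hc
  have hs4 : s ≤ 1 / 4 := by
    by_contra h
    push Not at h
    nlinarith
  set T := √(-Real.log c / π) with hT
  have hlog : 0 < -Real.log c := neg_pos.2 (Real.log_neg hc0 (by linarith))
  have hT0 : 0 < T := Real.sqrt_pos.2 (div_pos hlog hpi)
  have hcT : c = Real.exp (-(π * T ^ 2)) := by
    rw [hT, Real.sq_sqrt (div_pos hlog hpi).le, mul_div_cancel₀ _ pi_ne_zero, neg_neg,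
      Real.exp_log hc0]
  have hmin : ∫⁻ t in Ioi (0 : ℝ), ENNReal.ofReal (min (Real.exp (-(π * t ^ 2))) c) ≤
      ∫⁻ t in Ioi (0 : ℝ), ENNReal.ofReal (min ((Real.sin (π * t) / (π * t)) ^ 2) c) := by
    have h1 := ofReal_le_lintegral_min_sin_sq hs0
    have h2 := min_bound_comparison hs0 hs4 hT0 (hsc.trans hcT)
    rw [hsc] at h1 h2
    exact (lintegral_min_gaussian_le hT0 hcT).trans ((ENNReal.ofReal_le_ofReal h2).trans h1)
  have hfin : ∫⁻ t in Ioi (0 : ℝ), ENNReal.ofReal (min (Real.exp (-(π * t ^ 2))) c) ≠ ⊤ :=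
    ((lintegral_min_gaussian_le hT0 hcT).trans_lt ENNReal.ofReal_lt_top).ne
  refine (ENNReal.add_le_add_iff_right hfin).1 ?_
  calc _ ≤ (∫⁻ t in Ioi (0 : ℝ), ENNReal.ofReal ((Real.sin (π * t) / (π * t)) ^ 2 - c)) +
        ∫⁻ t in Ioi (0 : ℝ), ENNReal.ofReal (min ((Real.sin (π * t) / (π * t)) ^ 2) c) := by gcongr
    _ = ∫⁻ t in Ioi (0 : ℝ), ENNReal.ofReal ((Real.sin (π * t) / (π * t)) ^ 2) := by
      rw [← lintegral_add_left (by fun_prop)]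
      simp_rw [ofReal_sub_add_ofReal_min hc]
    _ ≤ ENNReal.ofReal (1 / 2) := lintegral_sin_sq_div_sq_le
    _ = ∫⁻ t in Ioi (0 : ℝ), ENNReal.ofReal (Real.exp (-(π * t ^ 2))) :=
      lintegral_gaussian_Ioi_zero.symm
    _ = _ := by
      rw [← lintegral_add_left (by fun_prop)]
      simp_rw [ofReal_sub_add_ofReal_min hc]

/-- The set defining the Luxemburg norm of a Gaussian is nonempty. -/
lemma exists_lintegral_gaussian_div_le_one {N : ℝ → ℝ} (hN : ConvexOn ℝ (Ici 0) N)
    (h0 : N 0 = 0) :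
    ∃ l : ℝ, 0 < l ∧
      ∫⁻ t in Ioi (0 : ℝ), ENNReal.ofReal (N (Real.exp (-(π * t ^ 2)) / l ^ 2)) ≤ 1 := by
  have hpi := pi_pos
  set l : ℝ := 1 + |N 1|
  have hl1 : 1 ≤ l := by linarith [abs_nonneg (N 1)]
  have hl0 : 0 < l := by linarith
  have hNl : N 1 ≤ l ^ 2 := by nlinarith [le_abs_self (N 1)]
  refine ⟨l, hl0, ?_⟩
  calc ∫⁻ t in Ioi (0 : ℝ), ENNReal.ofReal (N (Real.exp (-(π * t ^ 2)) / l ^ 2))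
      ≤ ∫⁻ t in Ioi (0 : ℝ), ENNReal.ofReal (Real.exp (-(π * t ^ 2))) := by
        refine lintegral_mono fun t => ENNReal.ofReal_le_ofReal ?_
        set x := Real.exp (-(π * t ^ 2))
        have hx0 : 0 < x := Real.exp_pos _
        have hx1 : x ≤ 1 := Real.exp_le_one_iff.2 (neg_nonpos.2 (by positivity))
        have hy1 : x / l ^ 2 ≤ 1 := by
          rw [div_le_one (by positivity)]; exact hx1.trans (one_le_pow₀ hl1)
        have hconv := hN.2 (mem_Ici.2 le_rfl) (mem_Ici.2 zero_le_one) (sub_nonneg.2 hy1)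
          (div_nonneg hx0.le (sq_nonneg l)) (sub_add_cancel _ _)
        simp only [smul_eq_mul, mul_zero, mul_one, zero_add, h0] at hconv
        refine hconv.trans ?_
        rw [div_mul_eq_mul_div, div_le_iff₀ (by positivity)]
        exact mul_le_mul_of_nonneg_left hNl hx0.le
    _ = ENNReal.ofReal (1 / 2) := lintegral_gaussian_Ioi_zero
    _ ≤ 1 := by
        rw [← ENNReal.ofReal_one]; exact ENNReal.ofReal_le_ofReal (by norm_num)

lemma lintegral_sin_sq_div_le_gaussian_div {N : ℝ → ℝ} (hN : ConvexOn ℝ (Ici 0) N)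
    (hc : ContinuousOn N (Ici 0)) (hm : MonotoneOn N (Ici 0)) (h0 : N 0 = 0)
    {l : ℝ} (hl : 0 < l) :
    ∫⁻ t in Ioi (0 : ℝ), ENNReal.ofReal (N ((Real.sin (π * t) / (π * t)) ^ 2 / l ^ 2)) ≤
      ∫⁻ t in Ioi (0 : ℝ), ENNReal.ofReal (N (Real.exp (-(π * t ^ 2)) / l ^ 2)) := by
  refine ConvexOn.lintegral_comp_le (fun t => by positivity) (fun t => by positivity)
    (by fun_prop) (by fun_prop) hN hc hm h0 fun c hc0 => ?_
  have hscale : ∀ x : ℝ, ENNReal.ofReal (x / l ^ 2 - c) =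
      ENNReal.ofReal (1 / l ^ 2) * ENNReal.ofReal (x - l ^ 2 * c) := fun x => by
    rw [← ENNReal.ofReal_mul (by positivity)]
    congr 1
    field_simp
  simp_rw [hscale]
  rw [lintegral_const_mul _ (by fun_prop), lintegral_const_mul _ (by fun_prop)]
  exact mul_le_mul_right (lintegral_sin_sq_sub_le_gaussian_sub (mul_nonneg (sq_nonneg l) hc0)) _

/-- Extension of Ball's integral inequality to Orlicz spaces: if `M` and `u ↦ M(√u)` are
Orlicz functions, then `‖sin(πt)/(πt)‖_{L_M} ≤ ‖e^{−πt²/2}‖_{L_M}`. -/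
theorem statement12 (M : ℝ → ℝ) (hM : IsOrlicz M)
    (hM2 : IsOrlicz (fun u => M (Real.sqrt u))) :
    luxNorm M (fun t => |Real.sin (π * t) / (π * t)|) ≤
      luxNorm M (fun t => Real.exp (-(π * t ^ 2) / 2)) := by
  obtain ⟨hcont, hconv, hmono, h0, -⟩ := hM2
  have hg : ∀ l : ℝ, 0 < l → ∀ t : ℝ, M (|(|Real.sin (π * t) / (π * t)|)| / l) =
      M (√((Real.sin (π * t) / (π * t)) ^ 2 / l ^ 2)) := fun l hl t => by
    rw [abs_abs, ← div_pow, Real.sqrt_sq_eq_abs, abs_div _ l, abs_of_pos hl]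
  have hf : ∀ l : ℝ, 0 < l → ∀ t : ℝ, M (|Real.exp (-(π * t ^ 2) / 2)| / l) =
      M (√(Real.exp (-(π * t ^ 2)) / l ^ 2)) := fun l hl t => by
    rw [Real.sqrt_div (Real.exp_pos _).le, Real.sqrt_sq hl.le, Real.exp_half,
      abs_of_nonneg (Real.sqrt_nonneg _)]
  refine csInf_le_csInf ⟨0, fun l hl => hl.1.le⟩ ?_ ?_
  · obtain ⟨l, hl, h⟩ := exists_lintegral_gaussian_div_le_one hconv h0
    refine ⟨l, hl, ?_⟩
    simp_rw [hf l hl]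
    exact h
  · rintro l ⟨hl, h⟩
    refine ⟨hl, ?_⟩
    simp_rw [hf l hl] at h
    simp_rw [hg l hl]
    exact (lintegral_sin_sq_div_le_gaussian_div hconv hcont hmono.monotoneOn h0 hl).trans h
end

section
/- Let 0 < α < 1 and define f(t) = χ_{(0,1)}(t) + t^{−α} χ_{[1,∞)}(t) and g(t) = χ_{(0,2)}(t) + t^{−α} χ_{[2,∞)}(t) for t > 0, and let ‖h‖_{M(t^α)} = sup_{t>0} t^{α−1} ∫₀^t h*(u) du be the Marcinkiewicz norm. Then: (i) f* = f and g* = g, and the pair (f,g) satisfies f*(t) ≥ g*(t) for t ≤ 1 and f*(t) ≤ g*(t) for t ≥ 1; (ii) ‖f‖_{M(t^α)} = ‖g‖_{M(t^α)} = 1/(1−α); (iii) ‖f·χ_{(0,2)}‖_{M(t^α)} = (1 − α·2^{α−1})/(1−α) < 2^α = ‖g·χ_{(0,2)}‖_{M(t^α)}. Consequently, the Marcinkiewicz space M(t^α) does not belong to the class 𝒳. -/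
open MeasureTheory Set Real Filter
open scoped ENNReal NNReal

/-- The distribution function `λ_f(τ) = |{t > 0 : |f t| > τ}|` of a function on `(0,∞)`
with respect to Lebesgue measure. -/
noncomputable def distribFn (f : ℝ → ℝ) (τ : ℝ) : ℝ≥0∞ :=
  (volume.restrict (Set.Ioi (0:ℝ))) {t : ℝ | τ < |f t|}

/-- The non-increasing rearrangement `f*(s) = inf{τ > 0 : λ_f(τ) ≤ s}`. -/
noncomputable def rearr (f : ℝ → ℝ) (s : ℝ) : ℝ :=
  sInf {τ : ℝ | 0 < τ ∧ distribFn f τ ≤ ENNReal.ofReal s}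

/-- Condition (D): there is `τ₀ ∈ (0,∞)` such that `λ_f(τ) ≤ λ_g(τ)` for `τ < τ₀` and
`λ_f(τ) ≥ λ_g(τ)` for `τ > τ₀`. -/
def CondD (f g : ℝ → ℝ) : Prop :=
  ∃ τ₀ : ℝ, 0 < τ₀ ∧ (∀ τ : ℝ, 0 < τ → τ < τ₀ → distribFn f τ ≤ distribFn g τ) ∧
    (∀ τ : ℝ, τ₀ < τ → distribFn g τ ≤ distribFn f τ)

/-- The Marcinkiewicz norm `‖h‖_{M(t^α)} = sup_{t>0} t^{α−1} ∫₀^t h*(u) du`,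
valued in `ℝ≥0∞`. -/
noncomputable def marcNorm (α : ℝ) (h : ℝ → ℝ) : ℝ≥0∞ :=
  ⨆ t ∈ Set.Ioi (0:ℝ), ENNReal.ofReal (t ^ (α - 1) * ∫ u in Set.Ioc (0:ℝ) t, rearr h u)

open scoped Topology

/-- A non-negative, non-increasing, right-continuous function on `(0,∞)`. -/
structure IsDecreasingRC (h : ℝ → ℝ) : Prop where
  nonneg : ∀ t, 0 < t → 0 ≤ h t
  anti : AntitoneOn h (Ioi 0)
  rightCont : ∀ t, 0 < t → ContinuousWithinAt h (Ici t) t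

lemma IsDecreasingRC.distribFn_le_iff {h : ℝ → ℝ} (hh : IsDecreasingRC h) {t τ : ℝ}
    (ht : 0 < t) : distribFn h τ ≤ ENNReal.ofReal t ↔ h t ≤ τ := by
  have hset : distribFn h τ = volume ({u : ℝ | τ < |h u|} ∩ Ioi 0) :=
    Measure.restrict_apply' measurableSet_Ioi
  rw [hset]
  constructor
  · intro hle
    by_contra! hlt
    have hev : ∀ᶠ u in 𝓝[≥] t, τ < h u := (hh.rightCont t ht).eventually_const_lt hlt
    obtain ⟨b, hb, hsub⟩ := mem_nhdsGE_iff_exists_Ico_subset.1 hev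
    have hb' : t < b := hb
    have hincl : Ioo 0 b ⊆ {u : ℝ | τ < |h u|} ∩ Ioi 0 := by
      intro u hu
      refine ⟨show τ < |h u| from lt_of_lt_of_le ?_ (le_abs_self _), hu.1⟩
      rcases le_total t u with htu | hut
      · exact hsub ⟨htu, hu.2⟩
      · exact hlt.trans_le (hh.anti hu.1 ht hut)
    have := (measure_mono hincl).trans hle
    rw [Real.volume_Ioo, sub_zero, ENNReal.ofReal_le_ofReal_iff ht.le] at this
    exact this.not_gt hb'
  · intro hle
    have hincl : {u : ℝ | τ < |h u|} ∩ Ioi 0 ⊆ Ioo 0 t := by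
      rintro u ⟨hu, hu0⟩
      refine ⟨hu0, ?_⟩
      by_contra! htu
      rw [mem_ofPred_eq, abs_of_nonneg (hh.nonneg u hu0)] at hu
      exact (hu.trans_le (hh.anti ht hu0 htu)).not_ge hle
    simpa using measure_mono (μ := volume) hincl

lemma IsDecreasingRC.rearr_eq {h : ℝ → ℝ} (hh : IsDecreasingRC h) {t : ℝ} (ht : 0 < t) :
    rearr h t = h t := by
  have h0 := hh.nonneg t ht
  simp only [rearr, hh.distribFn_le_iff ht]
  apply le_antisymm
  · refine le_of_forall_pos_le_add fun ε hε => csInf_le ⟨0, fun τ hτ => hτ.1.le⟩ ⟨?_, ?_⟩ <;>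
      linarith
  · exact le_csInf ⟨h t + 1, by linarith, by linarith⟩ fun τ hτ => hτ.2

lemma IsDecreasingRC.indicator {h : ℝ → ℝ} (hh : IsDecreasingRC h) (s : ℝ) :
    IsDecreasingRC ((Ioo 0 s).indicator h) where
  nonneg t ht := indicator_nonneg (fun u hu => hh.nonneg u hu.1) t
  anti := by
    intro u hu v hv huv
    by_cases hvs : v < s
    · rw [indicator_of_mem (show v ∈ Ioo 0 s from ⟨hv, hvs⟩),
        indicator_of_mem (show u ∈ Ioo 0 s from ⟨hu, huv.trans_lt hvs⟩)]
      exact hh.anti hu hv huv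
    · rw [indicator_of_notMem (fun hm => hvs hm.2)]
      exact indicator_nonneg (fun u hu => hh.nonneg u hu.1) u
  rightCont t ht := by
    rcases lt_or_ge t s with hts | hst
    · refine (hh.rightCont t ht).congr_of_eventuallyEq ?_ (indicator_of_mem (show t ∈ Ioo 0 s from ⟨ht, hts⟩) h)
      filter_upwards [mem_nhdsWithin_of_mem_nhds (Ioo_mem_nhds ht hts)] with u hu
      exact indicator_of_mem hu h
    · have hz : ∀ u ∈ Ici t, (Ioo 0 s).indicator h u = 0 := fun u hu =>
        indicator_of_notMem (fun hm => (hst.trans hu).not_gt hm.2) h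
      exact continuousWithinAt_const.congr hz (hz t self_mem_Ici)

lemma IsDecreasingRC.marcNorm_eq {h : ℝ → ℝ} (hh : IsDecreasingRC h) (α : ℝ) :
    marcNorm α h = ⨆ t ∈ Ioi (0:ℝ), ENNReal.ofReal (t ^ (α - 1) * ∫ u in Ioc 0 t, h u) := by
  refine iSup_congr fun t => iSup_congr fun _ => ?_
  rw [setIntegral_congr_fun measurableSet_Ioc fun u hu => hh.rearr_eq hu.1]

/-- An upper bound on the weighted averages that is attained equals the Marcinkiewicz norm. -/
lemma IsDecreasingRC.marcNorm_eq_of_max {h : ℝ → ℝ} (hh : IsDecreasingRC h) {α s C : ℝ}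
    (hs : 0 < s) (hle : ∀ t, 0 < t → t ^ (α - 1) * ∫ u in Ioc 0 t, h u ≤ C)
    (heq : s ^ (α - 1) * ∫ u in Ioc 0 s, h u = C) : marcNorm α h = ENNReal.ofReal C := by
  rw [hh.marcNorm_eq]
  refine le_antisymm (iSup₂_le fun t ht => ENNReal.ofReal_le_ofReal (hle t ht)) ?_
  rw [← heq]
  exact le_iSup₂ (f := fun t (_ : t ∈ Ioi (0:ℝ)) =>
    ENNReal.ofReal (t ^ (α - 1) * ∫ u in Ioc 0 t, h u)) s hs

/-- An upper bound on the weighted averages that is their limit at infinity equals the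
Marcinkiewicz norm. -/
lemma IsDecreasingRC.marcNorm_eq_of_tendsto {h : ℝ → ℝ} (hh : IsDecreasingRC h) {α C : ℝ}
    (hle : ∀ t, 0 < t → t ^ (α - 1) * ∫ u in Ioc 0 t, h u ≤ C)
    (hlim : Tendsto (fun t => t ^ (α - 1) * ∫ u in Ioc 0 t, h u) atTop (𝓝 C)) :
    marcNorm α h = ENNReal.ofReal C := by
  rw [hh.marcNorm_eq]
  refine le_antisymm (iSup₂_le fun t ht => ENNReal.ofReal_le_ofReal (hle t ht)) ?_
  refine le_of_tendsto (ENNReal.tendsto_ofReal hlim) ?_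
  filter_upwards [Ioi_mem_atTop (0:ℝ)] with t ht
  exact le_iSup₂ (f := fun t (_ : t ∈ Ioi (0:ℝ)) =>
    ENNReal.ofReal (t ^ (α - 1) * ∫ u in Ioc 0 t, h u)) t ht

lemma setIntegral_indicator_Ioo (h : ℝ → ℝ) (s t : ℝ) :
    ∫ u in Ioc 0 t, (Ioo 0 s).indicator h u = ∫ u in Ioc 0 (min t s), h u := by
  rw [setIntegral_indicator measurableSet_Ioo]
  refine setIntegral_congr_set ?_
  have : (Ioc 0 t ∩ Ioc 0 s : Set ℝ) = Ioc 0 (min t s) := by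
    rw [Ioc_inter_Ioc, max_self]
  rw [← this]
  exact (ae_eq_refl _).inter Ioo_ae_eq_Ioc

/-- `h` equals `χ_{(0,a)} + t^{-α} χ_{[a,∞)}` on `(0,∞)`. -/
def IsCutPower (α a : ℝ) (h : ℝ → ℝ) : Prop :=
  ∀ t : ℝ, 0 < t → h t = if t < a then 1 else t ^ (-α)

namespace IsCutPower

variable {α a : ℝ} {h : ℝ → ℝ}

lemma isDecreasingRC (hh : IsCutPower α a h) (hα : 0 < α) (ha : 1 ≤ a) :
    IsDecreasingRC h where
  nonneg t ht := by
    rw [hh t ht]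
    split_ifs
    · exact zero_le_one
    · positivity
  anti := by
    intro u hu v hv huv
    have hu' : 0 < u := hu
    rw [hh u hu, hh v hv]
    split_ifs with h1 h2 h2
    · exact le_rfl
    · linarith
    · exact rpow_le_one_of_one_le_of_nonpos (by linarith) (by linarith)
    · exact rpow_le_rpow_of_nonpos hu' huv (by linarith)
  rightCont t ht := by
    rcases lt_or_ge t a with hta | hat
    · refine (continuousWithinAt_const (b := (1:ℝ))).congr_of_eventuallyEq ?_ ?_
      · filter_upwards [mem_nhdsWithin_of_mem_nhds (Ioo_mem_nhds ht hta)] with u hu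
        rw [hh u hu.1, if_pos hu.2]
      · rw [hh t ht, if_pos hta]
    · have heq : ∀ u ∈ Ici t, h u = u ^ (-α) := fun u hu => by
        rw [hh u (ht.trans_le hu), if_neg (hat.trans hu).not_gt]
      exact (continuousAt_rpow_const t _ (Or.inl ht.ne')).continuousWithinAt.congr heq
        (heq t self_mem_Ici)

lemma integral_of_le (hh : IsCutPower α a h) {t : ℝ} (ht : 0 < t) (hta : t ≤ a) :
    ∫ u in Ioc 0 t, h u = t := by
  rw [integral_Ioc_eq_integral_Ioo, setIntegral_congr_fun (g := fun _ => (1:ℝ))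
    measurableSet_Ioo fun u hu => by rw [hh u hu.1, if_pos (hu.2.trans_le hta)]]
  simp [ht.le]

lemma integral_of_ge (hh : IsCutPower α a h) (hα : 0 < α) (hα1 : α < 1) (ha : 1 ≤ a) {t : ℝ}
    (hat : a ≤ t) : ∫ u in Ioc 0 t, h u = a + (t ^ (1 - α) - a ^ (1 - α)) / (1 - α) := by
  have ha0 : 0 < a := by linarith
  have hcongr : EqOn h (fun u => u ^ (-α)) (Ioc a t) := fun u hu => by
    rw [hh u (ha0.trans hu.1), if_neg hu.1.le.not_gt]
  have hint1 : IntegrableOn h (Ioc 0 a) := by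
    rw [integrableOn_Ioc_iff_integrableOn_Ioo]
    refine IntegrableOn.congr_fun (f := fun _ => (1:ℝ)) (by simp) (fun u hu => ?_)
      measurableSet_Ioo
    rw [hh u hu.1, if_pos hu.2]
  have hint2 : IntegrableOn h (Ioc a t) := by
    refine IntegrableOn.congr_fun ?_ hcongr.symm measurableSet_Ioc
    exact (intervalIntegrable_iff_integrableOn_Ioc_of_le hat).1
      (intervalIntegral.intervalIntegrable_rpow' (by linarith))
  rw [← Ioc_union_Ioc_eq_Ioc ha0.le hat, setIntegral_union (Ioc_disjoint_Ioc_of_le le_rfl)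
    measurableSet_Ioc hint1 hint2, hh.integral_of_le ha0 le_rfl,
    setIntegral_congr_fun measurableSet_Ioc hcongr, ← intervalIntegral.integral_of_le hat,
    integral_rpow (Or.inl (by linarith)), show -α + 1 = 1 - α by ring]

lemma average_of_le (hh : IsCutPower α a h) {t : ℝ} (ht : 0 < t) (hta : t ≤ a) :
    t ^ (α - 1) * ∫ u in Ioc 0 t, h u = t ^ α := by
  rw [hh.integral_of_le ht hta, ← rpow_add_one ht.ne', sub_add_cancel]

lemma average_of_ge (hh : IsCutPower α a h) (hα : 0 < α) (hα1 : α < 1) (ha : 1 ≤ a) {t : ℝ}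
    (hat : a ≤ t) : t ^ (α - 1) * ∫ u in Ioc 0 t, h u =
      1 / (1 - α) + (a - a ^ (1 - α) / (1 - α)) * t ^ (α - 1) := by
  have ht : 0 < t := by linarith
  have hmul : t ^ (α - 1) * t ^ (1 - α) = 1 := by
    rw [← rpow_add ht, show α - 1 + (1 - α) = 0 by ring, rpow_zero]
  rw [hh.integral_of_ge hα hα1 ha hat]
  linear_combination hmul / (1 - α)

lemma marcNorm_eq (hh : IsCutPower α a h) (hα : 0 < α) (hα1 : α < 1) (ha : 1 ≤ a)
    (hbound : a ^ α ≤ 1 / (1 - α)) : marcNorm α h = ENNReal.ofReal (1 / (1 - α)) := by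
  have ha0 : 0 < a := by linarith
  refine (hh.isDecreasingRC hα ha).marcNorm_eq_of_tendsto (fun t ht => ?_) ?_
  · rcases le_total t a with hta | hat
    · rw [hh.average_of_le ht hta]
      exact (rpow_le_rpow ht.le hta hα.le).trans hbound
    · rw [hh.average_of_ge hα hα1 ha hat]
      have hmul : a ^ α * a ^ (1 - α) = a := by
        rw [← rpow_add ha0, show α + (1 - α) = 1 by ring, rpow_one]
      have hc : a ≤ a ^ (1 - α) / (1 - α) := by
        calc a = a ^ α * a ^ (1 - α) := hmul.symm
          _ ≤ 1 / (1 - α) * a ^ (1 - α) := by gcongr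
          _ = a ^ (1 - α) / (1 - α) := by ring
      have ht' : 0 ≤ t ^ (α - 1) := rpow_nonneg ht.le _
      nlinarith
  · have hlim : Tendsto (fun t : ℝ => t ^ (α - 1)) atTop (𝓝 0) := by
      simpa using tendsto_rpow_neg_atTop (show 0 < 1 - α by linarith)
    have := (hlim.const_mul (a - a ^ (1 - α) / (1 - α))).const_add (1 / (1 - α))
    rw [mul_zero, add_zero] at this
    refine this.congr' ?_
    filter_upwards [eventually_ge_atTop a] with t ht
    exact (hh.average_of_ge hα hα1 ha ht).symm

end IsCutPower

/-- If the averages of `h` over `(0,t]`, `t ≤ s`, are largest at `s`, their value there is the norm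
of the truncation of `h` at `s`. -/
lemma IsDecreasingRC.marcNorm_indicator {h : ℝ → ℝ} (hh : IsDecreasingRC h) {α s C : ℝ}
    (hα1 : α < 1) (hs : 0 < s)
    (hle : ∀ t, 0 < t → t ≤ s → t ^ (α - 1) * ∫ u in Ioc 0 t, h u ≤ C)
    (heq : s ^ (α - 1) * ∫ u in Ioc 0 s, h u = C) :
    marcNorm α ((Ioo 0 s).indicator h) = ENNReal.ofReal C := by
  refine (hh.indicator s).marcNorm_eq_of_max hs (fun t ht => ?_) ?_
  · rw [setIntegral_indicator_Ioo]
    rcases le_total t s with hts | hst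
    · rw [min_eq_left hts]
      exact hle t ht hts
    · rw [min_eq_right hst, ← heq]
      exact mul_le_mul_of_nonneg_right (rpow_le_rpow_of_nonpos hs hst (by linarith))
        (setIntegral_nonneg measurableSet_Ioc fun u hu => hh.nonneg u hu.1)
  · rw [setIntegral_indicator_Ioo, min_self, heq]

lemma two_rpow_lt_one_add {x : ℝ} (hx0 : 0 < x) (hx1 : x < 1) : (2:ℝ) ^ x < 1 + x := by
  have := rpow_one_add_lt_one_add_mul_self (s := 1) (by norm_num) one_ne_zero hx0 hx1
  norm_num at this
  exact this

/-- The Marcinkiewicz space `M(t^α)`, `0 < α < 1`, does not belong to the class `𝒳`: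
for `f = χ_{(0,1)} + t^{−α}χ_{[1,∞)}` and `g = χ_{(0,2)} + t^{−α}χ_{[2,∞)}` one has
(i) `f* = f`, `g* = g` on `(0,∞)` and `(f,g)` satisfies the (NP) crossing at `t₀ = 1`;
(ii) `‖f‖ = ‖g‖ = 1/(1−α)`;
(iii) `‖f·χ_{(0,2)}‖ = (1 − α2^{α−1})/(1−α) < 2^α = ‖g·χ_{(0,2)}‖`;
consequently `M(t^α) ∉ 𝒳`. -/
theorem statement14 (α : ℝ) (hα0 : 0 < α) (hα1 : α < 1)
    (f g : ℝ → ℝ)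
    (hfdef : ∀ t : ℝ, 0 < t → f t = if t < 1 then 1 else t ^ (-α))
    (hgdef : ∀ t : ℝ, 0 < t → g t = if t < 2 then 1 else t ^ (-α)) :
    (∀ t : ℝ, 0 < t → rearr f t = f t) ∧
    (∀ t : ℝ, 0 < t → rearr g t = g t) ∧
    (∀ t : ℝ, 0 < t → t ≤ 1 → rearr g t ≤ rearr f t) ∧
    (∀ t : ℝ, 1 ≤ t → rearr f t ≤ rearr g t) ∧
    marcNorm α f = ENNReal.ofReal (1 / (1 - α)) ∧
    marcNorm α g = ENNReal.ofReal (1 / (1 - α)) ∧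
    marcNorm α (Set.indicator (Set.Ioo 0 2) f) =
      ENNReal.ofReal ((1 - α * 2 ^ (α - 1)) / (1 - α)) ∧
    marcNorm α (Set.indicator (Set.Ioo 0 2) g) = ENNReal.ofReal ((2:ℝ) ^ α) ∧
    marcNorm α (Set.indicator (Set.Ioo 0 2) f) <
      marcNorm α (Set.indicator (Set.Ioo 0 2) g) ∧
    ¬ (∀ F G : ℝ → ℝ,
        (∃ t₀ : ℝ, 0 < t₀ ∧ (∀ t : ℝ, 0 < t → t ≤ t₀ → rearr G t ≤ rearr F t) ∧
          (∀ t : ℝ, t₀ ≤ t → rearr F t ≤ rearr G t)) →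
        marcNorm α G ≤ marcNorm α F →
        ∀ s : ℝ, 0 < s →
          marcNorm α (Set.indicator (Set.Ioo 0 s) (rearr G)) ≤
            marcNorm α (Set.indicator (Set.Ioo 0 s) (rearr F))) := by
  have hf : IsCutPower α 1 f := hfdef
  have hg : IsCutPower α 2 g := hgdef
  have hfd := hf.isDecreasingRC hα0 le_rfl
  have hgd := hg.isDecreasingRC hα0 one_le_two
  have hpos : 0 < 1 - α := by linarith
  have hfr : ∀ t : ℝ, 0 < t → rearr f t = f t := fun t => hfd.rearr_eq
  have hgr : ∀ t : ℝ, 0 < t → rearr g t = g t := fun t => hgd.rearr_eq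
  have hnp1 : ∀ t : ℝ, 0 < t → t ≤ 1 → rearr g t ≤ rearr f t := by
    intro t ht ht1
    rw [hfr t ht, hgr t ht, hfdef t ht, hgdef t ht, if_pos (by linarith)]
    split_ifs
    · exact le_rfl
    · exact one_le_rpow_of_pos_of_le_one_of_nonpos ht ht1 (by linarith)
  have hnp2 : ∀ t : ℝ, 1 ≤ t → rearr f t ≤ rearr g t := by
    intro t ht
    have ht0 : 0 < t := by linarith
    rw [hfr t ht0, hgr t ht0, hfdef t ht0, hgdef t ht0, if_neg ht.not_gt]
    split_ifs
    · exact rpow_le_one_of_one_le_of_nonpos ht (by linarith)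
    · exact le_rfl
  have hfn : marcNorm α f = ENNReal.ofReal (1 / (1 - α)) := by
    refine hf.marcNorm_eq hα0 hα1 le_rfl ?_
    rw [one_rpow, le_div_iff₀ hpos]
    linarith
  have hgn : marcNorm α g = ENNReal.ofReal (1 / (1 - α)) := by
    refine hg.marcNorm_eq hα0 hα1 one_le_two ?_
    rw [le_div_iff₀ hpos]
    nlinarith [two_rpow_lt_one_add hα0 hα1]
  have hform : ∀ x : ℝ, 1 / (1 - α) + (1 - 1 ^ (1 - α) / (1 - α)) * x =
      (1 - α * x) / (1 - α) := by
    intro x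
    rw [one_rpow]
    field_simp
    ring
  have hft : marcNorm α (Set.indicator (Set.Ioo 0 2) f) =
      ENNReal.ofReal ((1 - α * 2 ^ (α - 1)) / (1 - α)) := by
    refine hfd.marcNorm_indicator hα1 two_pos (fun t ht ht2 => ?_) ?_
    · rcases le_total t 1 with ht1 | ht1
      · rw [hf.average_of_le ht ht1, le_div_iff₀ hpos]
        have h1 : t ^ α ≤ 1 := rpow_le_one ht.le ht1 hα0.le
        have h2 : (2:ℝ) ^ (α - 1) ≤ 1 :=
          rpow_le_one_of_one_le_of_nonpos one_le_two (by linarith)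
        nlinarith
      · rw [hf.average_of_ge hα0 hα1 le_rfl ht1, hform]
        have : (2:ℝ) ^ (α - 1) ≤ t ^ (α - 1) := rpow_le_rpow_of_nonpos ht ht2 (by linarith)
        gcongr
    · rw [hf.average_of_ge hα0 hα1 le_rfl one_le_two, hform]
  have hgt : marcNorm α (Set.indicator (Set.Ioo 0 2) g) = ENNReal.ofReal ((2:ℝ) ^ α) := by
    refine hgd.marcNorm_indicator hα1 two_pos (fun t ht ht2 => ?_)
      (hg.average_of_le two_pos le_rfl)
    rw [hg.average_of_le ht ht2]
    exact rpow_le_rpow ht.le ht2 hα0.le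
  have hlt : marcNorm α (Set.indicator (Set.Ioo 0 2) f) <
      marcNorm α (Set.indicator (Set.Ioo 0 2) g) := by
    rw [hft, hgt, ENNReal.ofReal_lt_ofReal_iff (by positivity), div_lt_iff₀ hpos]
    have hx : (0:ℝ) < 2 ^ (α - 1) := by positivity
    have h2 : (2:ℝ) ^ α = 2 * 2 ^ (α - 1) := by
      rw [rpow_sub_one two_ne_zero]
      ring
    have hinv : (2:ℝ) ^ (α - 1) * 2 ^ (1 - α) = 1 := by
      rw [← rpow_add two_pos, show α - 1 + (1 - α) = 0 by ring, rpow_zero]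
    have hb := two_rpow_lt_one_add (x := 1 - α) hpos (by linarith)
    have := mul_lt_mul_of_pos_left hb hx
    rw [h2]
    linarith
  refine ⟨hfr, hgr, hnp1, hnp2, hfn, hgn, hft, hgt, hlt, fun H => ?_⟩
  have h2 := H f g ⟨1, one_pos, hnp1, hnp2⟩ (hgn.trans hfn.symm).le 2 two_pos
  rw [indicator_congr (f := rearr g) (g := g) fun t ht => hgr t ht.1,
    indicator_congr (f := rearr f) (g := f) fun t ht => hfr t ht.1] at h2
  exact h2.not_gt hlt
end
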